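/- arXiv:2309.14423 — 3 statements merged into one kernel-verified Lean document; each statement's English description precedes it below -/
import Mathlib

section
/- Let K be a field of characteristic zero, L a Lie algebra over K, and V a Lie module over L. Suppose e, e', f ∈ L satisfy ⁅e', f⁆ = 0 and ⁅e, ⁅e, e'⁆⁆ = 0, and suppose v ∈ V and a nonzero scalar c ∈ K satisfy e'·v = 0 and e·(f·v) = c•v. Then e'·(e·v) = 0. -/
/-- If `⁅e', f⁆ = 0`, `⁅e, ⁅e, e'⁆⁆ = 0`, `e'·v = 0` and `e·(f·v) = c•v` with `c ≠ 0`,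
then `e'·(e·v) = 0`. -/
theorem lie_act_eq_zero_of_serre {K L V : Type*} [Field K] [CharZero K]
    [LieRing L] [LieAlgebra K L]
    [AddCommGroup V] [Module K V] [LieRingModule L V] [LieModule K L V]
    (e e' f : L) (h1 : ⁅e', f⁆ = 0) (h2 : ⁅e, ⁅e, e'⁆⁆ = 0)
    (v : V) (c : K) (hc : c ≠ 0)
    (h3 : ⁅e', v⁆ = 0) (h4 : ⁅e, ⁅f, v⁆⁆ = c • v) :
    ⁅e', ⁅e, v⁆⁆ = 0 := by
  have hw : ⁅e', ⁅f, v⁆⁆ = 0 := by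
    rw [leibniz_lie, h1, h3, zero_lie, lie_zero, add_zero]
  have h5 : ⁅⁅e, ⁅e, e'⁆⁆, ⁅f, v⁆⁆ = 0 := by rw [h2, zero_lie]
  simp only [lie_lie, hw, h4, lie_smul, h3, lie_zero, smul_zero, sub_zero, zero_sub,
    neg_neg] at h5
  simpa [hc] using h5
end

section
/- Let K be a field of characteristic zero and L a Lie algebra over K. Suppose e, f, h ∈ L form an sl2 triple, i.e. ⁅h,e⁆ = 2•e, ⁅h,f⁆ = -2•f, ⁅e,f⁆ = h, and suppose the adjoint endomorphisms ad e and ad f of L are nilpotent, so that exp(ad f), exp(-ad e) : L → L are defined by their (finite) power series. Set r = exp(ad f) ∘ exp(-ad e) ∘ exp(ad f). Then for every x ∈ L and c ∈ K satisfying ⁅x,e⁆ = c•e and ⁅x,f⁆ = -c•f, one has r(x) = x - c•h. -/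
theorem exp_aux {K L : Type*} [Field K] [AddCommGroup L] [Module K L]
    (N : Module.End K L) (n : ℕ) (hN : N ^ n = 0) (v : L) (hv : N (N (N v)) = 0) :
    (∑ k ∈ Finset.range n, ((k.factorial : K)⁻¹) • N ^ k) v
      = v + N v + (2 : K)⁻¹ • N (N v) := by
  have a1 : ∑ k ∈ Finset.range n, ((k.factorial : K)⁻¹) • N ^ k
      = ∑ k ∈ Finset.range (3 + n), ((k.factorial : K)⁻¹) • N ^ k := by
    apply Finset.sum_subset
    · intro k hk
      simp only [Finset.mem_range] at *
      omega
    · intro k _ hk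
      rw [pow_eq_zero_of_le (by simpa using hk) hN, smul_zero]
  have h3 : ∀ k, (N ^ (3 + k)) v = 0 := by
    intro k
    rw [add_comm, pow_add]
    simp [pow_succ, hv]
  rw [a1, Finset.sum_range_add, LinearMap.add_apply]
  simp [LinearMap.sum_apply, h3, Finset.sum_range_succ, pow_succ, Nat.factorial]

/-- For an sl2 triple `(e, f, h)` with `ad e` and `ad f` nilpotent, the automorphism
`r = exp(ad f) ∘ exp(-ad e) ∘ exp(ad f)` (exponentials given by their finite power
series) maps any `x` with `⁅x,e⁆ = c•e` and `⁅x,f⁆ = -c•f` to `x - c•h`. -/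
theorem weyl_reflection_on_cartan {K L : Type*} [Field K] [CharZero K]
    [LieRing L] [LieAlgebra K L]
    (e f h : L)
    (hhe : ⁅h, e⁆ = (2 : K) • e) (hhf : ⁅h, f⁆ = (-2 : K) • f) (hef : ⁅e, f⁆ = h)
    (n m : ℕ)
    (hadf : (LieAlgebra.ad K L f) ^ n = 0) (hade : (LieAlgebra.ad K L e) ^ m = 0)
    (expAdf expNegAde : Module.End K L)
    (h1 : expAdf = ∑ k ∈ Finset.range n, ((k.factorial : K)⁻¹) • (LieAlgebra.ad K L f) ^ k)
    (h2 : expNegAde = ∑ k ∈ Finset.range m, ((k.factorial : K)⁻¹) • (-(LieAlgebra.ad K L e)) ^ k)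
    (x : L) (c : K) (hxe : ⁅x, e⁆ = c • e) (hxf : ⁅x, f⁆ = -(c • f)) :
    expAdf (expNegAde (expAdf x)) = x - c • h := by
  have hfx : ⁅f, x⁆ = c • f := by rw [← lie_skew, hxf, neg_neg]
  have hex : ⁅e, x⁆ = -(c • e) := by rw [← lie_skew, hxe]
  have hfh : ⁅f, h⁆ = (2 : K) • f := by rw [← lie_skew, hhf]; module
  have heh : ⁅e, h⁆ = -((2 : K) • e) := by rw [← lie_skew, hhe]
  have hade' : (-(LieAlgebra.ad K L e)) ^ m = 0 := by rw [neg_pow, hade, mul_zero]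
  have e1 : expAdf x = x + c • f := by
    rw [h1, exp_aux _ n hadf] <;> simp [hfx]
  have e2 : expNegAde (x + c • f) = x + c • f - c • h := by
    rw [h2, exp_aux _ m hade']
    · simp [hex, hef, heh]
      module
    · simp [hex, hef, heh]
  have e3 : expAdf (x + c • f - c • h) = x - c • h := by
    rw [h1, exp_aux _ n hadf]
    · simp [hfx, hfh]
      module
    · simp [hfx, hfh]
  rw [e1, e2, e3]
end

section
/- Let K be an algebraically closed field of characteristic zero, L a finite-dimensional semisimple Lie algebra over K, and H a (splitting) Cartan subalgebra of L, so that L decomposes as the direct sum of H and the root spaces L_α over the (nonzero) roots α ∈ H* of L with respect to H; each root space is one-dimensional, the root system is reduced (the only multiples of a root α that are roots are ±α), and ⁅L_α, L_{-α}⁆ ⊆ H. Let V be a Lie module over L and F : H → V a linear map satisfying: (i) h·F(h') = 0 for all h, h' ∈ H; (ii) x·(x·F(h)) = 0 for every root α, every x ∈ L_α and every h ∈ H; (iii) x·(y·F(h)) = α(h) • F(⁅x,y⁆) for every root α, every x ∈ L_α, y ∈ L_{-α} and every h ∈ H (here ⁅x,y⁆ ∈ H); (iv) α(h) • (x·F(h'))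 = α(h') • (x·F(h)) for every root α, every x ∈ L_α and all h, h' ∈ H. Then there exists a linear map s : L → V such that s(h) = -F(h) for all h ∈ H, α(h) • s(x) = x·F(h) for every root α, every x ∈ L_α and every h ∈ H, and s(⁅z,w⁆) = z·s(w) for all z, w ∈ L; that is, s is a homomorphism of L-modules from the adjoint module L to V. -/
open LieAlgebra LieModule in
lemma sharp_ind {K L : Type*} [Field K] [IsAlgClosed K] [CharZero K]
    [LieRing L] [LieAlgebra K L] [FiniteDimensional K L] [LieAlgebra.IsKilling K L]
    (H : LieSubalgebra K L) [H.IsCartanSubalgebra] (P : L → Prop)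
    (hH : ∀ h : H, P h)
    (hR : ∀ α : Weight K H L, α.toLinear ≠ 0 → ∀ x ∈ rootSpace H α, P x)
    (hadd : ∀ x y, P x → P y → P (x + y)) (x : L) : P x := by
  have htop := congrArg LieSubmodule.toSubmodule (iSup_genWeightSpace_eq_top' K H L)
  rw [LieSubmodule.iSup_toSubmodule] at htop
  have hx : x ∈ ⨆ χ : Weight K H L, (genWeightSpace L (χ : H → K)).toSubmodule := by
    rw [htop]; trivial
  refine Submodule.iSup_induction _ (motive := P) hx ?_ ?_ hadd
  · intro χ y hy
    by_cases hχ : χ.toLinear = 0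
    · have h0 : (χ : H → K) = 0 := by
        ext h; exact LinearMap.congr_fun hχ h
      rw [h0] at hy
      have : y ∈ rootSpace H (0 : H → K) := hy
      rw [rootSpace_zero_eq] at this
      exact hH ⟨y, this⟩
    · exact hR χ hχ y hy
  · exact hH 0

open LieAlgebra LieModule in
lemma sharp_exists {K L V : Type*} [Field K] [IsAlgClosed K] [CharZero K]
    [LieRing L] [LieAlgebra K L] [FiniteDimensional K L] [LieAlgebra.IsKilling K L]
    (H : LieSubalgebra K L) [H.IsCartanSubalgebra]
    [AddCommGroup V] [Module K V]
    (f : ∀ χ : Weight K H L, rootSpace H χ →ₗ[K] V) :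
    ∃ s : L →ₗ[K] V, ∀ (χ : Weight K H L) (x : rootSpace H χ), s x = f χ x := by
  classical
  have htop := congrArg LieSubmodule.toSubmodule (iSup_genWeightSpace_eq_top' K H L)
  rw [LieSubmodule.iSup_toSubmodule] at htop
  have hind := LieSubmodule.iSupIndep_toSubmodule.mpr (iSupIndep_genWeightSpace' K H L)
  have hint := DirectSum.isInternal_submodule_of_iSupIndep_of_iSup_eq_top hind htop
  let A : Weight K H L → Submodule K L := fun χ => (genWeightSpace L (χ : H → K)).toSubmodule
  let g : ∀ χ, A χ →ₗ[K] V := f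
  let e := LinearEquiv.ofBijective (DirectSum.coeLinearMap A) hint
  refine ⟨(DirectSum.toModule K _ V g) ∘ₗ e.symm.toLinearMap, fun χ x => ?_⟩
  have : e.symm (x : L) = DirectSum.lof K _ (fun χ => A χ) χ x := by
    rw [LinearEquiv.symm_apply_eq]
    exact (DirectSum.coeLinearMap_lof A χ x).symm
  rw [LinearMap.comp_apply, LinearEquiv.coe_coe, this]
  exact DirectSum.toModule_lof K (φ := g) χ x

/-- Equivariance of the map `♯`: given a finite-dimensional semisimple Lie algebra `L`
over an algebraically closed field of characteristic zero with Cartan subalgebra `H`,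
a module `V` and a linear map `F : H → V` satisfying the relations (i)–(iv), there is
a homomorphism `s` of `L`-modules from the adjoint module `L` to `V` with
`s(h) = -F(h)` on `H` and `α(h) • s(x) = x·F(h)` for `x` in the root space of `α`. -/
theorem sharp_map_equivariant {K L V : Type*} [Field K] [IsAlgClosed K] [CharZero K]
    [LieRing L] [LieAlgebra K L] [FiniteDimensional K L] [LieAlgebra.IsSemisimple K L]
    (H : LieSubalgebra K L) [H.IsCartanSubalgebra]
    [AddCommGroup V] [Module K V] [LieRingModule L V] [LieModule K L V]
    (F : H →ₗ[K] V)
    (hi : ∀ h h' : H, ⁅(h : L), F h'⁆ = 0)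
    (hii : ∀ α : H →ₗ[K] K, α ≠ 0 → ∀ x ∈ LieAlgebra.rootSpace H (⇑α), ∀ h : H,
      ⁅x, ⁅x, F h⁆⁆ = 0)
    (hiii : ∀ α : H →ₗ[K] K, α ≠ 0 → ∀ x ∈ LieAlgebra.rootSpace H (⇑α),
      ∀ y ∈ LieAlgebra.rootSpace H (⇑(-α)), ∀ h h' : H, ⁅x, y⁆ = (h' : L) →
        ⁅x, ⁅y, F h⁆⁆ = α h • F h')
    (hiv : ∀ α : H →ₗ[K] K, α ≠ 0 → ∀ x ∈ LieAlgebra.rootSpace H (⇑α), ∀ h h' : H,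
      α h • ⁅x, F h'⁆ = α h' • ⁅x, F h⁆) :
    ∃ s : L →ₗ[K] V,
      (∀ h : H, s (h : L) = -F h) ∧
      (∀ α : H →ₗ[K] K, α ≠ 0 → ∀ x ∈ LieAlgebra.rootSpace H (⇑α), ∀ h : H,
        α h • s x = ⁅x, F h⁆) ∧
      (∀ z w : L, s ⁅z, w⁆ = ⁅z, s w⁆) := by
  have hK : LieAlgebra.IsKilling K L := inferInstance
  classical
  have hf : ∀ χ : LieModule.Weight K H L, ∃ f : LieAlgebra.rootSpace H χ →ₗ[K] V,
      (χ.toLinear = 0 → ∀ (x : LieAlgebra.rootSpace H χ) (h : H), (x : L) = h → f x = - F h) ∧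
      (χ.toLinear ≠ 0 → ∀ (x : LieAlgebra.rootSpace H χ) (h : H), χ h • f x = ⁅(x : L), F h⁆) := by
    intro χ
    by_cases hχ : χ.toLinear = 0
    · have h0 : (χ : H → K) = 0 := by
        ext h; exact LinearMap.congr_fun hχ h
      have hm : ∀ x : LieAlgebra.rootSpace H χ, (x : L) ∈ H := by
        rintro ⟨x, hx⟩
        rw [h0, LieAlgebra.rootSpace_zero_eq] at hx
        exact hx
      refine ⟨{ toFun := fun x => - F ⟨x, hm x⟩, map_add' := ?_, map_smul' := ?_ },
        ?_, fun h => absurd hχ h⟩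
      · intro x y
        rw [← neg_add, ← map_add]; rfl
      · intro c x
        rw [RingHom.id_apply, smul_neg, ← map_smul]; rfl
      · intro _ x h hx
        have : (⟨x, hm x⟩ : H) = h := Subtype.ext hx
        simp [this]
    · obtain ⟨h0, hh0⟩ : ∃ h0, χ h0 ≠ 0 := by
        by_contra! hc
        exact hχ (LinearMap.ext hc)
      refine ⟨{ toFun := fun x => (χ h0)⁻¹ • ⁅(x : L), F h0⁆, map_add' := ?_, map_smul' := ?_ },
        fun h => absurd h hχ, ?_⟩
      · intro x y; simp
      · intro c x; simp [smul_comm c]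
      · intro _ x h
        have := hiv χ.toLinear hχ x x.2 h h0
        change χ h • (χ h0)⁻¹ • ⁅(x : L), F h0⁆ = _
        change χ h • ⁅(x : L), F h0⁆ = χ h0 • _ at this
        rw [smul_comm, this, inv_smul_smul₀ hh0]
  choose f hf0 hf1 using hf
  obtain ⟨s, hs⟩ := sharp_exists H f
  have wt : ∀ (χ : H → K) (x : L), x ∈ LieAlgebra.rootSpace H χ → x ≠ 0 →
      ∃ α : LieModule.Weight K H L, (α : H → K) = χ := by
    intro χ x hx hx0
    refine ⟨⟨χ, fun hb => hx0 ?_⟩, rfl⟩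
    have : x ∈ LieModule.genWeightSpace L χ := hx
    rw [hb] at this
    simpa using this
  have s0 : ∀ h : H, s (h : L) = -F h := by
    intro h
    by_cases hh : h = 0
    · simp [hh]
    have hm : (h : L) ∈ LieAlgebra.rootSpace H (0 : H → K) := by
      rw [LieAlgebra.rootSpace_zero_eq]; exact h.2
    obtain ⟨α, hα⟩ := wt 0 h hm (by simpa using hh)
    have := hs α ⟨h, by rw [hα]; exact hm⟩
    exact this.trans (hf0 α (by ext t; exact congrFun hα t) _ h rfl)
  have s1 : ∀ α : H →ₗ[K] K, α ≠ 0 → ∀ x ∈ LieAlgebra.rootSpace H (⇑α), ∀ h : H,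
        α h • s x = ⁅x, F h⁆ := by
    intro α hα x hx h
    by_cases hx0 : x = 0
    · simp [hx0]
    obtain ⟨β, hβ⟩ := wt α x hx hx0
    have hβl : β.toLinear = α := by ext t; exact congrFun hβ t
    have h2 := hf1 β (hβl ▸ hα) ⟨x, by rw [hβ]; exact hx⟩ h
    rw [← hs] at h2
    rw [← hβl]
    exact h2
  have ex : ∀ α : H →ₗ[K] K, α ≠ 0 → ∃ h, α h ≠ 0 := by
    intro α hα
    by_contra! hc
    exact hα (LinearMap.ext hc)
  refine ⟨s, s0, s1, ?_⟩
  intro z w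
  revert w
  refine sharp_ind H (fun z => ∀ w, s ⁅z, w⁆ = ⁅z, s w⁆) ?_ ?_ ?_ z
  · intro h w
    refine sharp_ind H (fun w => s ⁅(h : L), w⁆ = ⁅(h : L), s w⁆) ?_ ?_ ?_ w
    · intro h'
      have : ⁅(h : L), (h' : L)⁆ = 0 := by
        rw [← LieSubalgebra.coe_bracket, trivial_lie_zero]; rfl
      rw [this, s0, lie_neg, hi]; simp
    · intro α hα x hx
      obtain ⟨h0, hh0⟩ := ex _ hα
      have hl : ⁅(h : L), x⁆ = α h • x := LieAlgebra.IsKilling.lie_eq_smul_of_mem_rootSpace hx h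
      have h1 := s1 _ hα x hx h0
      rw [hl, map_smul]
      refine (smul_right_injective V hh0) ?_
      change α.toLinear K H L h0 • α h • s x = α.toLinear K H L h0 • ⁅(h : L), s x⁆
      rw [← lie_smul, h1, smul_comm, h1, leibniz_lie, hl, hi, lie_zero, add_zero, smul_lie]
    · intro x y hx hy
      simp only [lie_add, map_add, hx, hy]
  · intro α hα x hx w
    refine sharp_ind H (fun w => s ⁅x, w⁆ = ⁅x, s w⁆) ?_ ?_ ?_ w
    · intro h
      have hl : ⁅(h : L), x⁆ = α h • x := LieAlgebra.IsKilling.lie_eq_smul_of_mem_rootSpace hx h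
      have h1 : α h • s x = _ := s1 _ hα x hx h
      rw [← lie_skew, hl, map_neg, map_smul, h1, s0, lie_neg]
    · intro β hβ y hy
      by_cases hx0 : x = 0
      · simp [hx0]
      have hαn : α.IsNonZero := fun h => hα (by ext t; exact congrFun h t)
      have hβn : β.IsNonZero := fun h => hβ (by ext t; exact congrFun h t)
      by_cases hex : ∃ h, α h = 0 ∧ β h ≠ 0
      · obtain ⟨h, ha, hb⟩ := hex
        have hxy : ⁅x, y⁆ ∈ LieAlgebra.rootSpace H (⇑(α.toLinear + β.toLinear)) :=
          LieAlgebra.lie_mem_genWeightSpace_of_mem_genWeightSpace hx hy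
        have hne : α.toLinear + β.toLinear ≠ 0 := by
          intro h0
          have := LinearMap.congr_fun h0 h
          change α h + β h = 0 at this
          rw [ha, zero_add] at this
          exact hb this
        have h1 := s1 _ hne _ hxy h
        change (α h + β h) • _ = _ at h1
        rw [ha, zero_add] at h1
        have h2 : α h • s x = _ := s1 _ hα x hx h
        rw [ha, zero_smul] at h2
        have h3 : β h • s y = _ := s1 _ hβ y hy h
        refine (smul_right_injective V hb) ?_
        change β h • s ⁅x, y⁆ = β h • ⁅x, s y⁆
        rw [h1, ← lie_smul, h3, leibniz_lie x y, ← h2, lie_zero, add_zero]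
      · push Not at hex
        obtain ⟨h0, hh0⟩ := ex _ hα
        change α h0 ≠ 0 at hh0
        have hprop : (β : H → K) = (β h0 / α h0) • (α : H → K) := by
          ext h
          have h1 : α.toLinear K H L (h - (α h / α h0) • h0) = 0 := by
            rw [map_sub, map_smul]
            change α h - (α h / α h0) * α h0 = 0
            field_simp; ring
          have h2 : β.toLinear K H L (h - (α h / α h0) • h0) = 0 := hex _ h1
          rw [map_sub, map_smul] at h2
          change β h - (α h / α h0) * β h0 = 0 at h2
          change β h = (β h0 / α h0) * α h
          rw [sub_eq_zero.mp h2]; ring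
        rcases LieAlgebra.IsKilling.eq_neg_or_eq_of_eq_smul α β hβn _ hprop with rfl | rfl
        · have hxy : ⁅x, y⁆ ∈ LieAlgebra.rootSpace H (α + (-α : H → K)) :=
            LieAlgebra.lie_mem_genWeightSpace_of_mem_genWeightSpace hx hy
          rw [add_neg_cancel, LieAlgebra.rootSpace_zero_eq] at hxy
          have h1 := hiii α.toLinear hα x hx y hy h0 ⟨_, hxy⟩ rfl
          have h2 := s1 _ hβ y hy h0
          have h3 := s0 ⟨_, hxy⟩
          change s ⁅x, y⁆ = _ at h3
          rw [h3]
          rw [← h2, lie_smul] at h1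
          change (-(α h0)) • _ = α h0 • _ at h1
          rw [neg_smul, ← smul_neg] at h1
          rw [← smul_right_injective V hh0 h1, neg_neg]
        · obtain ⟨c, hc⟩ := (finrank_eq_one_iff_of_nonzero' (⟨x, hx⟩ : LieAlgebra.rootSpace H β)
            (by simpa using hx0)).mp (LieAlgebra.IsKilling.finrank_rootSpace_eq_one β hβn) ⟨y, hy⟩
          have hc' : y = c • x := (congrArg Subtype.val hc).symm
          have h1 := hii _ hα x hx h0
          rw [← s1 _ hα x hx h0, lie_smul] at h1
          have h2 := (smul_eq_zero.mp h1).resolve_left hh0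
          rw [hc', lie_smul, lie_self, map_smul, map_smul, lie_smul, h2]; simp
    · intro x y hx hy
      simp only [lie_add, map_add, hx, hy]
  · intro x y hx hy w
    simp only [add_lie, map_add, hx, hy]
end
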